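/- For every complex number s with Re(s) > 1, the function p₂ satisfies the functional equation p₂(2s) = p₂(s)² · q₂(s), where q₂(s) = L(s,χ)/ζ(s) · ∏_{p prime, p|d} (1 - p^{-s})^{-1}. -/

import Mathlib

open Complex NumberField Filter

noncomputable section

/-- The partial Euler product `∏_{p prime, χ(p) = ε} (1 - p^{-s})⁻¹`. -/
def eulerProd {d : ℕ} (χ : DirichletCharacter ℂ d) (ε : ℂ) (s : ℂ) : ℂ :=
  ∏' p : {p : Nat.Primes // χ ((p : Nat.Primes) : ℕ) = ε}, (1 - (((p : Nat.Primes) : ℕ) : ℂ) ^ (-s))⁻¹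

/-- `χ` is the Dirichlet character attached to the quadratic field `K`, i.e. the real
primitive quadratic character mod `d = |Δ_K|` given by the Kronecker symbol `(Δ_K/·)`:
at odd primes it is given by the Legendre symbol `(Δ_K/p)` and at `2` (when `2 ∤ d`)
by `χ₈(Δ_K)`. -/
def IsKroneckerCharacter (K : Type*) [Field K] [NumberField K] {d : ℕ}
    (χ : DirichletCharacter ℂ d) : Prop :=
  d = (NumberField.discr K).natAbs ∧ χ.IsPrimitive ∧ MulChar.IsQuadratic χ ∧
  (∀ (p : ℕ) (hp : p.Prime), p ≠ 2 →
    χ (p : ZMod d) = ((@legendreSym p ⟨hp⟩ (NumberField.discr K) : ℤ) : ℂ)) ∧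
  (¬ (2 : ℕ) ∣ d → χ ((2 : ℕ) : ZMod d) = ((ZMod.χ₈ ((NumberField.discr K : ℤ) : ZMod 8) : ℤ) : ℂ))

/-- `q₁(s) = ζ(2s)/(ζ(s)L(s,χ)) ∏_{p|d} (1+p^{-s})`. -/
def qOne {d : ℕ} [NeZero d] (χ : DirichletCharacter ℂ d) (s : ℂ) : ℂ :=
  riemannZeta (2 * s) / (riemannZeta s * DirichletCharacter.LFunction χ s) *
    ∏ p ∈ d.primeFactors, (1 + (p : ℂ) ^ (-s))

/-- `q₂(s) = L(s,χ)/ζ(s) ∏_{p|d} (1-p^{-s})⁻¹`. -/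
def qTwo {d : ℕ} [NeZero d] (χ : DirichletCharacter ℂ d) (s : ℂ) : ℂ :=
  DirichletCharacter.LFunction χ s / riemannZeta s *
    ∏ p ∈ d.primeFactors, (1 - (p : ℂ) ^ (-s))⁻¹

theorem multipliable_mulIndicator_primes_eulerFactor (S : Set Nat.Primes) {s : ℂ}
    (hs : 1 < s.re) :
    Multipliable (S.mulIndicator fun p : Nat.Primes ↦ (1 - (p : ℂ) ^ (-s))⁻¹) := by
  have hsum : Summable fun p : Nat.Primes ↦
      ‖S.mulIndicator (fun p : Nat.Primes ↦ (1 - (p : ℂ) ^ (-s))⁻¹) p - 1‖ := by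
    have hr : Summable fun p : Nat.Primes ↦ 2 * (p : ℝ) ^ (-s.re) :=
      (Nat.Primes.summable_rpow.mpr (by linarith)).mul_left 2
    refine hr.of_nonneg_of_le (fun _ ↦ norm_nonneg _) fun p ↦ ?_
    by_cases hp : p ∈ S
    · have hx : ‖(p : ℂ) ^ (-s)‖ = (p : ℝ) ^ (-s.re) := by
        rw [norm_natCast_cpow_of_pos p.prop.pos, neg_re]
      have hhalf := norm_prime_cpow_le_one_half p hs
      have hden : 1 / 2 ≤ ‖1 - (p : ℂ) ^ (-s)‖ := by
        have := norm_sub_norm_le (1 : ℂ) ((p : ℂ) ^ (-s))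
        rw [norm_one] at this
        linarith
      have hne : 1 - (p : ℂ) ^ (-s) ≠ 0 := norm_pos_iff.mp (by linarith)
      have heq : (1 - (p : ℂ) ^ (-s))⁻¹ - 1 = (p : ℂ) ^ (-s) / (1 - (p : ℂ) ^ (-s)) := by
        field_simp
        ring
      rw [Set.mulIndicator_of_mem hp, heq, norm_div, hx, div_le_iff₀ (by linarith)]
      nlinarith [norm_nonneg ((p : ℂ) ^ (-s))]
    · rw [Set.mulIndicator_of_notMem hp, sub_self, norm_zero]
      positivity
  simpa using multipliable_one_add_of_summable hsum

theorem hasProd_eulerProd {d : ℕ} (χ : DirichletCharacter ℂ d) (ε : ℂ) {s : ℂ}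
    (hs : 1 < s.re) :
    HasProd ({p : Nat.Primes | χ (p : ℕ) = ε}.mulIndicator
      fun p : Nat.Primes ↦ (1 - (p : ℂ) ^ (-s))⁻¹) (eulerProd χ ε s) := by
  have h := (multipliable_mulIndicator_primes_eulerFactor
    {p : Nat.Primes | χ (p : ℕ) = ε} hs).hasProd
  rwa [← tprod_subtype] at h

theorem qTwo_eq_LFunction_div {d : ℕ} [NeZero d] (χ : DirichletCharacter ℂ d) {s : ℂ}
    (hs : s ≠ 1) :
    qTwo χ s = χ.LFunction s / (1 : DirichletCharacter ℂ d).LFunction s := by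
  have h := DirichletCharacter.LFunctionTrivChar_eq_mul_riemannZeta (N := d) hs
  rw [DirichletCharacter.LFunctionTrivChar] at h
  rw [qTwo, h, Finset.prod_inv_distrib]
  field_simp

/-- The functional equation `p₂(2s) = p₂(s)² ⬝ q₂(s)` for `Re s > 1`. -/
theorem statement6 (K : Type*) [Field K] [NumberField K]
    (hK : Module.finrank ℚ K = 2) {d : ℕ} [NeZero d] (χ : DirichletCharacter ℂ d)
    (hχ : IsKroneckerCharacter K χ)
    (s : ℂ) (hs : 1 < s.re) :
    eulerProd χ (-1) (2 * s) = eulerProd χ (-1) s ^ 2 * qTwo χ s := by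
  have hs1 : s ≠ 1 := by
    rintro rfl
    simp at hs
  have hs2 : 1 < (2 * s).re := by
    simp only [mul_re, re_ofNat, im_ofNat, zero_mul, sub_zero]
    linarith
  have hL : (1 : DirichletCharacter ℂ d).LFunction s ≠ 0 :=
    DirichletCharacter.LFunction_ne_zero_of_one_le_re 1 (.inr hs1) hs.le
  rw [qTwo_eq_LFunction_div χ hs1, ← mul_div_assoc, eq_div_iff hL,
    DirichletCharacter.LFunction_eq_LSeries _ hs, DirichletCharacter.LFunction_eq_LSeries _ hs]
  refine ((hasProd_eulerProd χ (-1) hs2).mul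
    (DirichletCharacter.LSeries_eulerProduct_hasProd 1 hs)).unique ?_
  rw [pow_two]
  convert ((hasProd_eulerProd χ (-1) hs).mul (hasProd_eulerProd χ (-1) hs)).mul
    (DirichletCharacter.LSeries_eulerProduct_hasProd χ hs) using 2 with p
  have hsq : (p : ℂ) ^ (-(2 * s)) = ((p : ℂ) ^ (-s)) ^ 2 := by
    rw [← cpow_nat_mul]
    congr 1
    push_cast
    ring
  have hhalf := norm_prime_cpow_le_one_half p hs
  have hne {u : ℂ} (hu : ‖u‖ = 1) : (p : ℂ) ^ (-s) ≠ u := by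
    rintro rfl
    linarith
  have hsub : 1 - (p : ℂ) ^ (-s) ≠ 0 := sub_ne_zero.mpr (hne norm_one).symm
  have hadd : 1 + (p : ℂ) ^ (-s) ≠ 0 := fun h ↦
    hne (u := -1) (by simp) (by linear_combination h)
  simp only [Set.mulIndicator_apply, Set.mem_ofPred_eq]
  by_cases hp : IsUnit ((p : ℕ) : ZMod d)
  · rw [MulChar.one_apply hp, hsq]
    rcases hχ.2.2.1 (p : ℕ) with h | h | h
    · exact absurd h (hp.map χ).ne_zero
    · norm_num [h]
    · have hfac : 1 - ((p : ℂ) ^ (-s)) ^ 2 = (1 - (p : ℂ) ^ (-s)) * (1 + (p : ℂ) ^ (-s)) := by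
        ring
      simp only [h, if_true, hfac, one_mul, neg_mul, sub_neg_eq_add]
      field_simp
  · simp [MulChar.map_nonunit _ hp]
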